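/- There are no ring-contact triangles among quadrics when one is regular: if A, B, C are symmetric 4×4 real matrices with C invertible, and there exist covectors p, q, r ∈ ℝ⁴ and a scalar α with B = A + p·pᵀ, C = B + q·qᵀ, and A = α·C + r·rᵀ, then α = 1 and p·pᵀ + q·qᵀ + r·rᵀ = 0, hence all three planes p, q, r represent the same projective plane (the vectors p, q, r are pairwise linearly dependent). -/

import Mathlib

open Matrix

/-- Three linear forms in four variables have a common nontrivial zero. -/
theorem exists_ne_zero_dotProduct_three_eq_zero (p q r : Fin 4 → ℝ) :
    ∃ x : Fin 4 → ℝ, x ≠ 0 ∧ p ⬝ᵥ x = 0 ∧ q ⬝ᵥ x = 0 ∧ r ⬝ᵥ x = 0 := by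
  have hdet : (Matrix.of ![p, q, r, 0]).det = 0 :=
    Matrix.det_eq_zero_of_row_eq_zero 3 fun _ => rfl
  obtain ⟨x, hx, hx0⟩ := Matrix.exists_mulVec_eq_zero_iff.mpr hdet
  exact ⟨x, hx, congrFun hx0 0, congrFun hx0 1, congrFun hx0 2⟩

/-- Real rank-one squares that add up to zero all vanish. -/
theorem eq_zero_of_vecMulVec_self_add_eq_zero {n : Type*} {p q r : n → ℝ}
    (h : vecMulVec p p + vecMulVec q q + vecMulVec r r = 0) : p = 0 ∧ q = 0 ∧ r = 0 := by
  have key : ∀ i, p i * p i + q i * q i + r i * r i = 0 := fun i => congrFun (congrFun h i) i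
  refine ⟨funext fun i => ?_, funext fun i => ?_, funext fun i => ?_⟩ <;>
    exact mul_self_eq_zero.mp <| by
      linarith [key i, mul_self_nonneg (p i), mul_self_nonneg (q i), mul_self_nonneg (r i)]

/-- No ring-contact triangles among quadrics when one is regular. -/
theorem no_ring_contact_triangles
    (A B C : Matrix (Fin 4) (Fin 4) ℝ)
    (hA : A.IsSymm) (hB : B.IsSymm) (hC : C.IsSymm)
    (hCinv : IsUnit C.det)
    (p q r : Fin 4 → ℝ) (α : ℝ)
    (h1 : B = A + vecMulVec p p)
    (h2 : C = B + vecMulVec q q)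
    (h3 : A = α • C + vecMulVec r r) :
    α = 1 ∧ vecMulVec p p + vecMulVec q q + vecMulVec r r = 0 ∧
      (∃ a b : ℝ, ¬(a = 0 ∧ b = 0) ∧ a • p + b • q = 0) ∧
      (∃ a b : ℝ, ¬(a = 0 ∧ b = 0) ∧ a • p + b • r = 0) ∧
      (∃ a b : ℝ, ¬(a = 0 ∧ b = 0) ∧ a • q + b • r = 0) := by
  have hsum : vecMulVec p p + vecMulVec q q + vecMulVec r r = (1 - α) • C := by
    have hcycle : C = α • C + vecMulVec r r + vecMulVec p p + vecMulVec q q := by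
      rw [← h3, ← h1, ← h2]
    rw [sub_smul, one_smul, eq_sub_iff_add_eq]
    exact Eq.trans (by abel) hcycle.symm
  obtain ⟨x, hx, hp, hq, hr⟩ := exists_ne_zero_dotProduct_three_eq_zero p q r
  have hα : α = 1 := by
    have hCx : (1 - α) • (C *ᵥ x) = 0 := by
      rw [← smul_mulVec, ← hsum]
      simp [add_mulVec, vecMulVec_mulVec, hp, hq, hr]
    rcases smul_eq_zero.mp hCx with h | h
    · linarith
    · exact absurd (Matrix.exists_mulVec_eq_zero_iff.mp ⟨x, hx, h⟩) hCinv.ne_zero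
  have hzero : vecMulVec p p + vecMulVec q q + vecMulVec r r = 0 := by
    rw [hsum, hα, sub_self, zero_smul]
  obtain ⟨rfl, rfl, rfl⟩ := eq_zero_of_vecMulVec_self_add_eq_zero hzero
  exact ⟨hα, hzero, ⟨1, 1, by simp⟩, ⟨1, 1, by simp⟩, ⟨1, 1, by simp⟩⟩
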